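/- arXiv:1803.02472 — 3 statements merged into one kernel-verified Lean document; each statement's English description precedes it below -/
import Mathlib

section
/- Classification Theorem: let E be a permutation-invariant equivalence relation on Set M. Then for every X : Set M, the bicardinal slice E(⊟)_X is trivial, separative, or complementative. If Cardinal.mk M > 2, then exactly one of the following holds: E(⊟)_X is trivial, properly separative, or properly complementative. Moreover, if X is a finite set, then [X]_{E(⊟)} equals [X]_⊟, or equals {X}, or equals {X, Xᶜ}. -/
/-- Bicardinal equivalence: `X ⊟ Y` iff `|X| = |Y|` and `|Xᶜ| = |Yᶜ|`. -/
def Bicard {M : Type*} (X Y : Set M) : Prop :=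
  Cardinal.mk X = Cardinal.mk Y ∧ Cardinal.mk (Xᶜ : Set M) = Cardinal.mk (Yᶜ : Set M)

/-- `a ⊴ b`: there is `n : ℕ` with `a ≤ n * b`. -/
def Trile (a b : Cardinal) : Prop := ∃ n : ℕ, a ≤ n * b

/-- `a ◁ b`: `a ⊴ b` and not `b ⊴ a`. -/
def Trilt (a b : Cardinal) : Prop := Trile a b ∧ ¬ Trile b a

/-- Permutation invariance of a relation on concepts. -/
def PermInv {M : Type*} (E : Set M → Set M → Prop) : Prop :=
  ∀ (π : M ≃ M) (X Y : Set M), E X Y ↔ E (π '' X) (π '' Y)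

/-- The bicardinal slice `E(⊟)_X` is trivial. -/
def TrivialSlice {M : Type*} (E : Set M → Set M → Prop) (X : Set M) : Prop :=
  ∀ Y Z : Set M, Bicard Y X → Bicard Z X → E Y Z

/-- The bicardinal slice `E(⊟)_X` is separative (refines a separation). -/
def Separative {M : Type*} (E : Set M → Set M → Prop) (X : Set M) : Prop :=
  ∀ Y Z : Set M, Bicard Y X → Bicard Z X → E Y Z →
    Trilt (Cardinal.mk (symmDiff Y Z : Set M)) (Cardinal.mk X)

/-- The bicardinal slice `E(⊟)_X` is complementative (refines a complementation). -/
def Complementative {M : Type*} (E : Set M → Set M → Prop) (X : Set M) : Prop :=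
  ∀ Y Z : Set M, Bicard Y X → Bicard Z X → E Y Z →
    Trilt (Cardinal.mk (symmDiff Y Z : Set M)) (Cardinal.mk X) ∨
      Trilt (Cardinal.mk ((symmDiff Y Z)ᶜ : Set M)) (Cardinal.mk X)

/-- Properly separative: separative and not trivial. -/
def ProperlySeparative {M : Type*} (E : Set M → Set M → Prop) (X : Set M) : Prop :=
  Separative E X ∧ ¬ TrivialSlice E X

/-- Properly complementative: complementative, not separative, and not trivial. -/
def ProperlyComplementative {M : Type*} (E : Set M → Set M → Prop) (X : Set M) : Prop :=
  Complementative E X ∧ ¬ Separative E X ∧ ¬ TrivialSlice E X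


section Transport

variable {M : Type*} {E : Set M → Set M → Prop} {X Y Z U V W P Q S : Set M}

/-- Two pairs of sets whose four Venn cells have matching cardinalities are related by a
permutation, so an invariant relation cannot tell them apart. -/
theorem PermInv.of_cells (hPI : PermInv E)
    (h11 : Cardinal.mk (Y ∩ Z : Set M) = Cardinal.mk (U ∩ W : Set M))
    (h10 : Cardinal.mk (Y \ Z : Set M) = Cardinal.mk (U \ W : Set M))
    (h01 : Cardinal.mk (Z \ Y : Set M) = Cardinal.mk (W \ U : Set M))
    (h00 : Cardinal.mk ((Y ∪ Z)ᶜ : Set M) = Cardinal.mk ((U ∪ W)ᶜ : Set M))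
    (h : E Y Z) : E U W := by
  classical
  let f : M → Prop × Prop := fun x => (x ∈ Y, x ∈ Z)
  let g : M → Prop × Prop := fun x => (x ∈ U, x ∈ W)
  have e : ∀ c : Prop × Prop, Nonempty ({a // f a = c} ≃ {b // g b = c}) := by
    rintro ⟨p, q⟩
    rw [← Cardinal.eq]
    have hf : ∀ (A B T : Set M),
        (∀ x, x ∈ T ↔ ((x ∈ A) = p ∧ (x ∈ B) = q)) →
        Cardinal.mk {a : M // ((a ∈ A, a ∈ B) : Prop × Prop) = (p, q)} = Cardinal.mk T := by
      intro A B T hT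
      refine Cardinal.mk_congr (Equiv.subtypeEquivRight fun x => ?_)
      rw [hT, Prod.mk.injEq]
    by_cases hp : p <;> by_cases hq : q
    · exact (hf Y Z (Y ∩ Z) (by simp [hp, hq])).trans
        (h11.trans (hf U W (U ∩ W) (by simp [hp, hq])).symm)
    · exact (hf Y Z (Y \ Z) (by simp [hp, hq])).trans
        (h10.trans (hf U W (U \ W) (by simp [hp, hq])).symm)
    · exact (hf Y Z (Z \ Y) (by simp [hp, hq, and_comm])).trans
        (h01.trans (hf U W (W \ U) (by simp [hp, hq, and_comm])).symm)
    · exact (hf Y Z (Y ∪ Z)ᶜ (by simp [hp, hq])).trans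
        (h00.trans (hf U W (U ∪ W)ᶜ (by simp [hp, hq])).symm)
  let π : M ≃ M := Equiv.ofFiberEquiv fun c => (e c).some
  have hπ : ∀ x, g (π x) = f x := fun x => Equiv.ofFiberEquiv_map _ x
  have hU : ∀ x, π x ∈ U ↔ x ∈ Y := fun x => Eq.to_iff (congrArg Prod.fst (hπ x))
  have hW : ∀ x, π x ∈ W ↔ x ∈ Z := fun x => Eq.to_iff (congrArg Prod.snd (hπ x))
  have himU : π '' Y = U := by
    ext y
    obtain ⟨x, rfl⟩ := π.surjective y
    rw [π.injective.mem_set_image, hU]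
  have himW : π '' Z = W := by
    ext y
    obtain ⟨x, rfl⟩ := π.surjective y
    rw [π.injective.mem_set_image, hW]
  have := (hPI π Y Z).1 h
  rwa [himU, himW] at this

/-- Exchanging a part of a set for another set of the same size preserves cardinality. -/
theorem mk_diff_union_of_mk_eq (hP : P ⊆ S) (hQ : Disjoint Q S)
    (hPQ : Cardinal.mk P = Cardinal.mk Q) :
    Cardinal.mk (S \ P ∪ Q : Set M) = Cardinal.mk S := by
  rw [Cardinal.mk_union_of_disjoint (hQ.symm.mono_left Set.sdiff_subset), ← hPQ,
    Cardinal.mk_sdiff_add_mk hP]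

/-- The slice is closed under exchanging `P ⊆ Y` for an equinumerous `Q ⊆ Yᶜ`. -/
theorem Bicard.diff_union (hYX : Bicard Y X) (hP : P ⊆ Y) (hQ : Q ⊆ Yᶜ)
    (hPQ : Cardinal.mk P = Cardinal.mk Q) : Bicard (Y \ P ∪ Q) X := by
  have hc : (Y \ P ∪ Q)ᶜ = Yᶜ \ Q ∪ P := by
    ext x
    have h1 := @hP x
    have h2 := @hQ x
    simp only [Set.mem_compl_iff, Set.mem_union, Set.mem_sdiff] at *
    tauto
  constructor
  · rw [mk_diff_union_of_mk_eq hP (Set.subset_compl_iff_disjoint_right.1 hQ) hPQ, hYX.1]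
  · rw [hc, mk_diff_union_of_mk_eq hQ (Set.disjoint_compl_right_iff_subset.2 hP) hPQ.symm, hYX.2]

/-- If `Y` is equivalent to `Z`, it is equivalent to the result of exchanging equinumerous
parts `P ⊆ Y` and `Q ⊆ Yᶜ` that `Z` does not separate. -/
theorem PermInv.exchange (hE : Equivalence E) (hPI : PermInv E) (h : E Y Z)
    (hP : P ⊆ Y) (hQ : Q ⊆ Yᶜ) (hPQ : Cardinal.mk P = Cardinal.mk Q)
    (hZ : P ∪ Q ⊆ Z ∨ P ∪ Q ⊆ Zᶜ) : E Y (Y \ P ∪ Q) := by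
  refine hE.trans h (hE.symm ?_)
  rcases hZ with hZ | hZ
  · obtain ⟨hPZ, hQZ⟩ := Set.union_subset_iff.1 hZ
    have e1 : (Y \ P ∪ Q) ∩ Z = (Y ∩ Z) \ P ∪ Q := by grind
    have e2 : (Y \ P ∪ Q) \ Z = Y \ Z := by grind
    have e3 : Z \ (Y \ P ∪ Q) = (Z \ Y) \ Q ∪ P := by grind
    have e4 : ((Y \ P ∪ Q) ∪ Z)ᶜ = (Y ∪ Z)ᶜ := by grind
    refine hPI.of_cells ?_ (by rw [e2]) ?_ (by rw [e4]) h
    · rw [e1, mk_diff_union_of_mk_eq _ _ hPQ]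
      · exact Set.subset_inter hP (Set.subset_union_left.trans hZ)
      · exact (Set.subset_compl_iff_disjoint_right.1 hQ).mono_right Set.inter_subset_left
    · rw [e3, mk_diff_union_of_mk_eq _ _ hPQ.symm]
      · exact Set.subset_inter (Set.subset_union_right.trans hZ) hQ
      · exact Set.disjoint_sdiff_right.mono_left hP
  · obtain ⟨hPZ, hQZ⟩ := Set.union_subset_iff.1 hZ
    have e1 : (Y \ P ∪ Q) ∩ Z = Y ∩ Z := by grind
    have e2 : (Y \ P ∪ Q) \ Z = (Y \ Z) \ P ∪ Q := by grind
    have e3 : Z \ (Y \ P ∪ Q) = Z \ Y := by grind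
    have e4 : ((Y \ P ∪ Q) ∪ Z)ᶜ = (Y ∪ Z)ᶜ \ Q ∪ P := by grind
    refine hPI.of_cells (by rw [e1]) ?_ (by rw [e3]) ?_ h
    · rw [e2, mk_diff_union_of_mk_eq _ _ hPQ]
      · exact Set.subset_inter hP (Set.subset_union_left.trans hZ)
      · exact (Set.subset_compl_iff_disjoint_right.1 hQ).mono_right Set.sdiff_subset
    · rw [e4, mk_diff_union_of_mk_eq _ _ hPQ.symm]
      · rw [Set.compl_union]
        exact Set.subset_inter hQ (Set.subset_union_right.trans hZ)
      · exact Set.disjoint_compl_right_iff_subset.2 (hP.trans Set.subset_union_left)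

/-- If one exchange in the slice preserves `E`, so does every exchange of the same shape. -/
theorem PermInv.exchange_transport (hPI : PermInv E) {R T : Set M}
    (hP : P ⊆ Y) (hQ : Q ⊆ Yᶜ) (hR : R ⊆ U) (hT : T ⊆ Uᶜ)
    (hPR : Cardinal.mk P = Cardinal.mk R) (hQT : Cardinal.mk Q = Cardinal.mk T)
    (hin : Cardinal.mk (Y \ P : Set M) = Cardinal.mk (U \ R : Set M))
    (hout : Cardinal.mk (Yᶜ \ Q : Set M) = Cardinal.mk (Uᶜ \ T : Set M))
    (h : E Y (Y \ P ∪ Q)) : E U (U \ R ∪ T) := by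
  have cells : ∀ {A B C : Set M}, B ⊆ A → C ⊆ Aᶜ → A ∩ (A \ B ∪ C) = A \ B ∧
      A \ (A \ B ∪ C) = B ∧ (A \ B ∪ C) \ A = C ∧ (A ∪ (A \ B ∪ C))ᶜ = Aᶜ \ C := by
    intro A B C hB hC
    refine ⟨?_, ?_, ?_, ?_⟩ <;> grind
  obtain ⟨a1, a2, a3, a4⟩ := cells hP hQ
  obtain ⟨b1, b2, b3, b4⟩ := cells hR hT
  exact hPI.of_cells (by rw [a1, b1, hin]) (by rw [a2, b2, hPR]) (by rw [a3, b3, hQT])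
    (by rw [a4, b4, hout]) h

/-- If both the symmetric difference of two equivalent sets and its complement are big, then one
of the two sets admits big parts inside and outside that the other does not separate. -/
theorem exists_big_parts (hE : Equivalence E) {Big : Set M → Prop}
    (hBig : ∀ A B : Set M, Big (A ∪ B) → Big A ∨ Big B)
    (hY : Bicard Y X) (hZ : Bicard Z X) (h : E Y Z)
    (hs : Big (symmDiff Y Z)) (hc : Big (symmDiff Y Z)ᶜ) :
    ∃ Y Z P Q : Set M, Bicard Y X ∧ E Y Z ∧ P ⊆ Y ∧ Q ⊆ Yᶜ ∧ Big P ∧ Big Q ∧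
      (P ∪ Q ⊆ Z ∨ P ∪ Q ⊆ Zᶜ) := by
  have hc' : (symmDiff Y Z)ᶜ = (Y ∩ Z) ∪ (Y ∪ Z)ᶜ := by
    ext x
    simp only [Set.mem_symmDiff, Set.mem_compl_iff, Set.mem_union, Set.mem_inter_iff]
    tauto
  rw [hc'] at hc
  have hs' := hBig _ _ hs
  have hc'' := hBig _ _ hc
  clear hBig hs hc hc'
  rcases hs' with ha | hb <;> rcases hc'' with hi | ho
  · exact ⟨Z, Y, Y ∩ Z, Y \ Z, hZ, hE.symm h, by grind, by grind, hi, ha, Or.inl (by grind)⟩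
  · exact ⟨Y, Z, Y \ Z, (Y ∪ Z)ᶜ, hY, h, by grind, by grind, ha, ho, Or.inr (by grind)⟩
  · exact ⟨Y, Z, Y ∩ Z, Z \ Y, hY, h, by grind, by grind, hi, hb, Or.inl (by grind)⟩
  · exact ⟨Z, Y, Z \ Y, (Y ∪ Z)ᶜ, hZ, hE.symm h, by grind, by grind, hb, ho, Or.inr (by grind)⟩

end Transport

section Finite

variable {M : Type*} {E : Set M → Set M → Prop} {X : Set M}

theorem mk_diff_singleton_eq {A B : Set M} {a b : M} (ha : a ∈ A) (hb : b ∈ B)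
    (h : Cardinal.mk A = Cardinal.mk B) :
    Cardinal.mk (A \ {a} : Set M) = Cardinal.mk (B \ {b} : Set M) := by
  have h1 := Cardinal.mk_sdiff_add_mk (Set.singleton_subset_iff.2 ha)
  have h2 := Cardinal.mk_sdiff_add_mk (Set.singleton_subset_iff.2 hb)
  rw [Cardinal.mk_singleton] at h1 h2
  rw [← h1, ← h2] at h
  exact Cardinal.add_one_inj.1 h

/-- Single-element exchanges connect the slice of a finite set. -/
theorem trivialSlice_of_forall_exchange (hE : Equivalence E) (hX : X.Finite)
    (h : ∀ U : Set M, Bicard U X → ∀ u ∈ U, ∀ v ∉ U, E U (U \ {u} ∪ {v})) :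
    TrivialSlice E X := by
  have fin_of : ∀ {U : Set M}, Bicard U X → U.Finite := fun hU => by
    rw [← Cardinal.lt_aleph0_iff_set_finite, hU.1]
    exact hX.lt_aleph0
  have ncard_of : ∀ {U : Set M}, Bicard U X → U.ncard = X.ncard := fun hU =>
    congrArg Cardinal.toNat hU.1
  have key : ∀ (n : ℕ) (U V : Set M), Bicard U X → Bicard V X → (U \ V).ncard = n → E U V := by
    intro n
    induction n with
    | zero =>
      intro U V hU hV hn
      have hsub : U ⊆ V := by
        rw [Set.ncard_eq_zero ((fin_of hU).sdiff)] at hn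
        exact Set.sdiff_eq_empty.1 hn
      rw [Set.eq_of_subset_of_ncard_le hsub (by rw [ncard_of hU, ncard_of hV]) (fin_of hV)]
      exact hE.refl V
    | succ n ih =>
      intro U V hU hV hn
      obtain ⟨u, huU, huV⟩ : (U \ V).Nonempty :=
        Set.nonempty_of_ncard_ne_zero (by omega)
      obtain ⟨v, hvV, hvU⟩ : (V \ U).Nonempty := by
        rw [Set.sdiff_nonempty]
        intro hVU
        have := Set.eq_of_subset_of_ncard_le hVU (by rw [ncard_of hU, ncard_of hV]) (fin_of hU)
        exact huV (this ▸ huU)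
      have hU' : Bicard (U \ {u} ∪ {v}) X :=
        hU.diff_union (Set.singleton_subset_iff.2 huU) (Set.singleton_subset_iff.2 hvU)
          (by rw [Cardinal.mk_singleton, Cardinal.mk_singleton])
      refine hE.trans (h U hU u huU v hvU) (ih _ V hU' hV ?_)
      have : (U \ {u} ∪ {v}) \ V = (U \ V) \ {u} := by
        clear ih h hn
        grind
      rw [this, Set.ncard_sdiff_singleton_of_mem (show u ∈ U \ V from ⟨huU, huV⟩), hn,
        Nat.add_sub_cancel]
  exact fun U V hU hV => key _ U V hU hV rfl

theorem trivialSlice_of_finite (hE : Equivalence E) (hPI : PermInv E) (hX : X.Finite)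
    {Y Z : Set M} (hY : Bicard Y X) (hZ : Bicard Z X) (h : E Y Z)
    (hs : (symmDiff Y Z).Nonempty) (hc : (symmDiff Y Z)ᶜ.Nonempty) : TrivialSlice E X := by
  obtain ⟨Y, Z, P, Q, hY, h, hP, hQ, ⟨p, hp⟩, ⟨q, hq⟩, hPQ⟩ :=
    exists_big_parts hE (fun _ _ => Set.union_nonempty.1) hY hZ h hs hc
  have hp' : {p} ⊆ P := Set.singleton_subset_iff.2 hp
  have hq' : {q} ⊆ Q := Set.singleton_subset_iff.2 hq
  have hpq := Set.union_subset_union hp' hq'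
  have step : E Y (Y \ {p} ∪ {q}) := hPI.exchange hE h (hp'.trans hP) (hq'.trans hQ)
    (by rw [Cardinal.mk_singleton, Cardinal.mk_singleton]) (hPQ.imp hpq.trans hpq.trans)
  refine trivialSlice_of_forall_exchange hE hX fun U hU u hu v hv => ?_
  exact hPI.exchange_transport (hp'.trans hP) (hq'.trans hQ) (Set.singleton_subset_iff.2 hu)
    (Set.singleton_subset_iff.2 hv) (by rw [Cardinal.mk_singleton, Cardinal.mk_singleton])
    (by rw [Cardinal.mk_singleton, Cardinal.mk_singleton])
    (mk_diff_singleton_eq (hP hp) hu (hY.1.trans hU.1.symm))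
    (mk_diff_singleton_eq (hQ hq) hv (hY.2.trans hU.2.symm)) step

end Finite

section Infinite

universe u

variable {M : Type u} {E : Set M → Set M → Prop} {X : Set M} {κ : Cardinal.{u}}

/-- A set of size at least `κ` has a part of size `κ` whose removal does not affect its size. -/
theorem exists_subset_mk_eq_mk_diff_eq (hκ : Cardinal.aleph0 ≤ κ) {S : Set M}
    (h : κ ≤ Cardinal.mk S) :
    ∃ T ⊆ S, Cardinal.mk T = κ ∧ Cardinal.mk (S \ T : Set M) = Cardinal.mk S := by
  have hsum : Cardinal.mk (κ.out ⊕ S) = Cardinal.mk S := by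
    rw [Cardinal.mk_sum, Cardinal.lift_id, Cardinal.lift_id, Cardinal.mk_out,
      Cardinal.add_eq_right (hκ.trans h) h]
  obtain ⟨e⟩ := Cardinal.eq.1 hsum
  have hinl : Function.Injective fun k : κ.out => (e (Sum.inl k) : M) :=
    Subtype.val_injective.comp (e.injective.comp Sum.inl_injective)
  have hinr : Function.Injective fun s : S => (e (Sum.inr s) : M) :=
    Subtype.val_injective.comp (e.injective.comp Sum.inr_injective)
  refine ⟨Set.range fun k : κ.out => (e (Sum.inl k) : M), ?_, ?_, ?_⟩
  · rintro _ ⟨k, rfl⟩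
    exact (e (Sum.inl k)).2
  · rw [Cardinal.mk_range_eq _ hinl, Cardinal.mk_out]
  · rw [← Cardinal.mk_range_eq _ hinr]
    congr 2
    ext x
    constructor
    · rintro ⟨hxS, hx⟩
      obtain ⟨k | s, hk⟩ := e.surjective ⟨x, hxS⟩
      · exact absurd ⟨k, by simp [hk]⟩ hx
      · exact ⟨s, by simp [hk]⟩
    · rintro ⟨s, rfl⟩
      refine ⟨(e (Sum.inr s)).2, ?_⟩
      rintro ⟨k, hk⟩
      exact Sum.inl_ne_inr (e.injective (Subtype.ext hk))

theorem le_mk_or_le_mk_of_le_mk_union (hκ : Cardinal.aleph0 ≤ κ) (A B : Set M)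
    (h : κ ≤ Cardinal.mk (A ∪ B : Set M)) : κ ≤ Cardinal.mk A ∨ κ ≤ Cardinal.mk B := by
  by_contra! hlt
  exact absurd (h.trans (Cardinal.mk_union_le A B))
    (Cardinal.add_lt_of_lt hκ hlt.1 hlt.2).not_ge

/-- `W` splits `S`: removing `W` from `S` does not change its size, and `W` takes at least `κ`
elements of `S` if there are that many. -/
def Splits (κ : Cardinal.{u}) (W S : Set M) : Prop :=
  Cardinal.mk (S \ W : Set M) = Cardinal.mk S ∧
    (κ ≤ Cardinal.mk S → κ ≤ Cardinal.mk (S ∩ W : Set M))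

theorem Splits.union (hκ : Cardinal.aleph0 ≤ κ) {W A B : Set M} (hA : Splits κ W A)
    (hB : Splits κ W B) (hAB : Disjoint A B) : Splits κ W (A ∪ B) := by
  constructor
  · rw [Set.union_sdiff_distrib, Cardinal.mk_union_of_disjoint
      (hAB.mono Set.sdiff_subset Set.sdiff_subset), hA.1, hB.1, Cardinal.mk_union_of_disjoint hAB]
  · intro h
    rcases le_mk_or_le_mk_of_le_mk_union hκ A B h with h | h
    · exact (hA.2 h).trans (Cardinal.mk_le_mk_of_subset
        (Set.inter_subset_inter_left _ Set.subset_union_left))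
    · exact (hB.2 h).trans (Cardinal.mk_le_mk_of_subset
        (Set.inter_subset_inter_left _ Set.subset_union_right))

/-- Any two sets and their complements can be split simultaneously by a set of size at most `κ`. -/
theorem exists_splits (hκ : Cardinal.aleph0 ≤ κ) (U V : Set M) :
    ∃ W : Set M, Cardinal.mk W ≤ κ ∧ Splits κ W U ∧ Splits κ W Uᶜ ∧
      Splits κ W V ∧ Splits κ W Vᶜ := by
  have cells : ∀ {A B C D : Set M}, A ⊆ U ∩ V → B ⊆ U \ V → C ⊆ V \ U → D ⊆ (U ∪ V)ᶜ →
      U ∩ V ∩ (A ∪ B ∪ (C ∪ D)) = A ∧ U \ V ∩ (A ∪ B ∪ (C ∪ D)) = B ∧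
      V \ U ∩ (A ∪ B ∪ (C ∪ D)) = C ∧ (U ∪ V)ᶜ ∩ (A ∪ B ∪ (C ∪ D)) = D := by
    intro A B C D hA hB hC hD
    refine ⟨?_, ?_, ?_, ?_⟩ <;> grind
  have cover₁ : U ∩ V ∪ U \ V = U := by grind
  have cover₂ : V \ U ∪ (U ∪ V)ᶜ = Uᶜ := by grind
  have cover₃ : U ∩ V ∪ V \ U = V := by grind
  have cover₄ : U \ V ∪ (U ∪ V)ᶜ = Vᶜ := by grind
  have disj₁ : Disjoint (U ∩ V) (U \ V) := Set.disjoint_left.2 (by grind)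
  have disj₂ : Disjoint (V \ U) (U ∪ V)ᶜ := Set.disjoint_left.2 (by grind)
  have disj₃ : Disjoint (U ∩ V) (V \ U) := Set.disjoint_left.2 (by grind)
  have disj₄ : Disjoint (U \ V) (U ∪ V)ᶜ := Set.disjoint_left.2 (by grind)
  have pick : ∀ S : Set M, ∃ T ⊆ S, Cardinal.mk T ≤ κ ∧
      Cardinal.mk (S \ T : Set M) = Cardinal.mk S ∧ (κ ≤ Cardinal.mk S → κ ≤ Cardinal.mk T) := by
    intro S
    by_cases h : κ ≤ Cardinal.mk S
    · obtain ⟨T, hTS, hT, hd⟩ := exists_subset_mk_eq_mk_diff_eq hκ h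
      exact ⟨T, hTS, hT.le, hd, fun _ => hT.ge⟩
    · exact ⟨∅, Set.empty_subset S, by simp, by simp, fun h' => absurd h' h⟩
  choose T hTS hTκ hTd hT using pick
  have of_inter : ∀ {W S : Set M}, S ∩ W = T S → Splits κ W S := by
    intro W S h
    refine ⟨?_, fun hS => h ▸ hT S hS⟩
    rw [← Set.sdiff_self_inter, h, hTd]
  let W := (T (U ∩ V) ∪ T (U \ V)) ∪ (T (V \ U) ∪ T (U ∪ V)ᶜ)
  obtain ⟨e11, e10, e01, e00⟩ := cells (hTS (U ∩ V)) (hTS (U \ V)) (hTS (V \ U)) (hTS (U ∪ V)ᶜ)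
  have s11 : Splits κ W (U ∩ V) := of_inter e11
  have s10 : Splits κ W (U \ V) := of_inter e10
  have s01 : Splits κ W (V \ U) := of_inter e01
  have s00 : Splits κ W (U ∪ V)ᶜ := of_inter e00
  have small : ∀ {A B : Set M}, Cardinal.mk A ≤ κ → Cardinal.mk B ≤ κ →
      Cardinal.mk (A ∪ B : Set M) ≤ κ := fun hA hB =>
    (Cardinal.mk_union_le _ _).trans (Cardinal.add_le_of_le hκ hA hB)
  refine ⟨W, small (small (hTκ _) (hTκ _)) (small (hTκ _) (hTκ _)), ?_, ?_, ?_, ?_⟩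
  · exact cover₁ ▸ s11.union hκ s10 disj₁
  · exact cover₂ ▸ s01.union hκ s00 disj₂
  · exact cover₃ ▸ s11.union hκ s01 disj₃
  · exact cover₄ ▸ s10.union hκ s00 disj₄

theorem trivialSlice_of_infinite (hE : Equivalence E) (hPI : PermInv E)
    (hX : Cardinal.aleph0 ≤ Cardinal.mk X)
    {Y Z : Set M} (hY : Bicard Y X) (hZ : Bicard Z X) (h : E Y Z)
    (hs : Cardinal.mk X ≤ Cardinal.mk (symmDiff Y Z : Set M))
    (hc : Cardinal.mk X ≤ Cardinal.mk ((symmDiff Y Z)ᶜ : Set M)) : TrivialSlice E X := by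
  obtain ⟨Y, Z, P', Q', hY, h, hP', hQ', hbP, hbQ, hPQ'⟩ :=
    exists_big_parts hE (Big := fun S => Cardinal.mk X ≤ Cardinal.mk S)
      (le_mk_or_le_mk_of_le_mk_union hX) hY hZ h hs hc
  obtain ⟨P, hPP', hP, hPd⟩ := exists_subset_mk_eq_mk_diff_eq hX hbP
  obtain ⟨Q, hQQ', hQ, hQd⟩ := exists_subset_mk_eq_mk_diff_eq hX hbQ
  have hPQ := Set.union_subset_union hPP' hQQ'
  have step : E Y (Y \ P ∪ Q) := hPI.exchange hE h (hPP'.trans hP') (hQQ'.trans hQ')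
    (hP.trans hQ.symm) (hPQ'.imp hPQ.trans hPQ.trans)
  have hin : Cardinal.mk (Y \ P : Set M) = Cardinal.mk X := by
    refine le_antisymm ((Cardinal.mk_le_mk_of_subset Set.sdiff_subset).trans hY.1.le) ?_
    exact hbP.trans (hPd.ge.trans (Cardinal.mk_le_mk_of_subset (Set.sdiff_subset_sdiff_left hP')))
  have hout : Cardinal.mk (Yᶜ \ Q : Set M) = Cardinal.mk (Xᶜ : Set M) := by
    have e : Yᶜ \ Q = Yᶜ \ Q' ∪ Q' \ Q := by grind
    rw [e, Cardinal.mk_union_of_disjoint (Set.disjoint_left.2 (by grind)), hQd,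
      Cardinal.mk_sdiff_add_mk hQ', hY.2]
  have hXc : Cardinal.mk X ≤ Cardinal.mk (Xᶜ : Set M) :=
    hbQ.trans ((Cardinal.mk_le_mk_of_subset hQ').trans hY.2.le)
  have generic : ∀ U W : Set M, Bicard U X → Cardinal.mk W ≤ Cardinal.mk X →
      Splits (Cardinal.mk X) W U → Splits (Cardinal.mk X) W Uᶜ → E U W := by
    intro U W hU hW hs hs'
    have e : U \ (U \ W) ∪ Uᶜ ∩ W = W := by grind
    have e1 : U \ (U \ W) = U ∩ W := by grind
    have e2 : Uᶜ \ (Uᶜ ∩ W) = Uᶜ \ W := by grind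
    rw [← e]
    refine hPI.exchange_transport (hPP'.trans hP') (hQQ'.trans hQ') Set.sdiff_subset
      Set.inter_subset_left ?_ ?_ ?_ ?_ step
    · rw [hP, hs.1, hU.1]
    · rw [hQ]
      exact le_antisymm (hs'.2 (hXc.trans hU.2.ge))
        ((Cardinal.mk_le_mk_of_subset Set.inter_subset_right).trans hW)
    · rw [hin, e1]
      exact le_antisymm (hs.2 hU.1.ge)
        ((Cardinal.mk_le_mk_of_subset Set.inter_subset_right).trans hW)
    · rw [hout, e2, hs'.1, hU.2]
  intro U V hU hV
  obtain ⟨W, hW, hsU, hsU', hsV, hsV'⟩ := exists_splits hX U V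
  exact hE.trans (generic U W hU hW hsU hsU') (hE.symm (generic V W hV hW hsV hsV'))

end Infinite

section Classification

variable {M : Type*} {E : Set M → Set M → Prop} {X S : Set M}

theorem nonempty_of_not_trilt (hX : X.Nonempty)
    (h : ¬ Trilt (Cardinal.mk S) (Cardinal.mk X)) : S.Nonempty := by
  by_contra hS
  rw [Set.not_nonempty_iff_eq_empty] at hS
  subst hS
  refine h ⟨⟨0, by simp⟩, ?_⟩
  rintro ⟨n, hn⟩
  rw [Cardinal.mk_eq_zero (∅ : Set M), mul_zero, nonpos_iff_eq_zero,
    Cardinal.mk_set_eq_zero_iff] at hn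
  exact hX.ne_empty hn

theorem eq_empty_of_trilt_of_finite (hX : X.Finite)
    (h : Trilt (Cardinal.mk S) (Cardinal.mk X)) : S = ∅ := by
  by_contra hS
  refine h.2 ⟨X.ncard, ?_⟩
  have h1 : (1 : Cardinal) ≤ Cardinal.mk S := by
    rw [Cardinal.one_le_iff_ne_zero]
    exact fun h0 => hS (Cardinal.mk_set_eq_zero_iff.1 h0)
  calc Cardinal.mk X = (X.ncard : Cardinal) * 1 := by
        rw [mul_one, Set.cast_ncard hX]
    _ ≤ X.ncard * Cardinal.mk S := by gcongr

theorem mk_le_of_not_trilt (hX : Cardinal.aleph0 ≤ Cardinal.mk X)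
    (h : ¬ Trilt (Cardinal.mk S) (Cardinal.mk X)) : Cardinal.mk X ≤ Cardinal.mk S := by
  by_contra! hlt
  refine h ⟨⟨1, by simpa using hlt.le⟩, ?_⟩
  rintro ⟨n, hn⟩
  exact hn.not_gt (Cardinal.mul_lt_of_lt hX ((Cardinal.natCast_lt_aleph0).trans_le hX) hlt)

theorem trivialSlice_or_complementative (hE : Equivalence E) (hPI : PermInv E) (X : Set M) :
    TrivialSlice E X ∨ Complementative E X := by
  rcases X.eq_empty_or_nonempty with rfl | hne
  · left
    intro Y Z hY hZ
    have eq_empty : ∀ {U : Set M}, Bicard U ∅ → U = ∅ := fun hU =>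
      Cardinal.mk_set_eq_zero_iff.1 (hU.1.trans (Cardinal.mk_eq_zero _))
    rw [eq_empty hY, eq_empty hZ]
    exact hE.refl ∅
  by_contra! hcon
  obtain ⟨htriv, hcomp⟩ := hcon
  refine hcomp fun Y Z hY hZ h => ?_
  by_contra! hlt
  obtain ⟨hs, hc⟩ := hlt
  apply htriv
  rcases X.finite_or_infinite with hX | hX
  · exact trivialSlice_of_finite hE hPI hX hY hZ h (nonempty_of_not_trilt hne hs)
      (nonempty_of_not_trilt hne hc)
  · have hX' : Cardinal.aleph0 ≤ Cardinal.mk X := Cardinal.infinite_iff.1 hX.to_subtype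
    exact trivialSlice_of_infinite hE hPI hX' hY hZ h (mk_le_of_not_trilt hX' hs)
      (mk_le_of_not_trilt hX' hc)

theorem Complementative.eq_or_eq_compl (hX : X.Finite) (h : Complementative E X) {Y : Set M}
    (hY : Bicard Y X) (hXY : E X Y) : Y = X ∨ Y = Xᶜ := by
  rcases h X Y ⟨rfl, rfl⟩ hY hXY with h | h
  · have := eq_empty_of_trilt_of_finite hX h
    rw [← Set.bot_eq_empty, symmDiff_eq_bot] at this
    exact Or.inl this.symm
  · have := eq_empty_of_trilt_of_finite hX h
    rw [Set.compl_empty_iff, ← Set.top_eq_univ, symmDiff_eq_top] at this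
    exact Or.inr this.compl_eq.symm

end Classification

/-- Classification Theorem (formal Main Theorem). -/
theorem classification_theorem {M : Type*} (E : Set M → Set M → Prop)
    (hE : Equivalence E) (hPI : PermInv E) (X : Set M) :
    (TrivialSlice E X ∨ Separative E X ∨ Complementative E X) ∧
    (2 < Cardinal.mk M →
      ((TrivialSlice E X ∧ ¬ ProperlySeparative E X ∧ ¬ ProperlyComplementative E X) ∨
       (¬ TrivialSlice E X ∧ ProperlySeparative E X ∧ ¬ ProperlyComplementative E X) ∨
       (¬ TrivialSlice E X ∧ ¬ ProperlySeparative E X ∧ ProperlyComplementative E X))) ∧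
    (X.Finite →
      ({Y : Set M | Bicard Y X ∧ E X Y} = {Y : Set M | Bicard Y X} ∨
       {Y : Set M | Bicard Y X ∧ E X Y} = {X} ∨
       {Y : Set M | Bicard Y X ∧ E X Y} = {X, Xᶜ})) := by
  have main := trivialSlice_or_complementative hE hPI X
  refine ⟨by tauto, fun _ => ?_, fun hX => ?_⟩
  · unfold ProperlySeparative ProperlyComplementative
    tauto
  · rcases main with htriv | hcomp
    · left
      ext Y
      exact ⟨fun hY => hY.1, fun hY => ⟨hY, htriv X Y ⟨rfl, rfl⟩ hY⟩⟩
    · right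
      by_cases hc : Bicard Xᶜ X ∧ E X Xᶜ
      · right
        ext Y
        constructor
        · rintro ⟨hY, hXY⟩
          exact hcomp.eq_or_eq_compl hX hY hXY
        · rintro (rfl | rfl)
          · exact ⟨⟨rfl, rfl⟩, hE.refl _⟩
          · exact hc
      · left
        ext Y
        constructor
        · rintro ⟨hY, hXY⟩
          rcases hcomp.eq_or_eq_compl hX hY hXY with rfl | rfl
          · rfl
          · exact absurd ⟨hY, hXY⟩ hc
        · rintro rfl
          exact ⟨⟨rfl, rfl⟩, hE.refl _⟩
end

section
/- Let E be a permutation-invariant equivalence relation on Set M. Suppose Y ≠ X, E X Y, Z ⊆ Y \ X, and f : M → M restricts to an injection of Z into X \ Y (Set.InjOn f Z and f '' Z ⊆ X \ Y). Suppose further that |Z| ⊴ |X ∩ Y| or |Z| ⊴ |(X ∪ Y)ᶜ|. Then there is a bijection π : M ≃ M such that E (π '' X) X, Z ⊆ π '' (X \ Y) ⊆ π '' X, and for every x : M, π x ≠ x if and only if x ∈ Z ∪ f '' Z. -/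
open Set Cardinal

/-- Two disjoint equinumerous sets are exchanged by a permutation fixing everything else. -/
theorem exists_perm_exchange {M : Type*} {P Q : Set M} (hd : Disjoint P Q) (hc : #P = #Q) :
    ∃ π : M ≃ M, π '' P = Q ∧ π '' Q = P ∧ ∀ x, x ∉ P ∪ Q → π x = x := by
  classical
  obtain ⟨e⟩ := Cardinal.eq.1 hc
  have hPQ : ∀ x, x ∈ Q → x ∉ P := fun x hq hp => Set.disjoint_left.1 hd hp hq
  let φ : M → M := fun x =>
    if h : x ∈ P then e ⟨x, h⟩ else if h : x ∈ Q then e.symm ⟨x, h⟩ else x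
  have hP : ∀ (x : M) (h : x ∈ P), φ x = e ⟨x, h⟩ := fun x h => by simp [φ, h]
  have hQ : ∀ (x : M) (h : x ∈ Q), φ x = e.symm ⟨x, h⟩ := fun x h => by simp [φ, h, hPQ x h]
  have hN : ∀ x, x ∉ P ∪ Q → φ x = x := fun x h => by
    simp only [mem_union, not_or] at h
    simp [φ, h]
  have hinv : Function.Involutive φ := by
    intro x
    by_cases h : x ∈ P
    · rw [hP x h, hQ _ (e ⟨x, h⟩).2]
      simp
    by_cases h' : x ∈ Q
    · rw [hQ x h', hP _ (e.symm ⟨x, h'⟩).2]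
      simp
    have h'' : x ∉ P ∪ Q := by simp [h, h']
    rw [hN x h'', hN x h'']
  have hmP : ∀ x ∈ P, φ x ∈ Q := fun x h => by rw [hP x h]; exact (e _).2
  have hmQ : ∀ x ∈ Q, φ x ∈ P := fun x h => by rw [hQ x h]; exact (e.symm _).2
  refine ⟨hinv.toPerm, ?_, ?_, hN⟩
  · refine Subset.antisymm ?_ fun y hy => ⟨φ y, hmQ y hy, hinv y⟩
    rintro _ ⟨x, hx, rfl⟩
    exact hmP x hx
  · refine Subset.antisymm ?_ fun y hy => ⟨φ y, hmP y hy, hinv y⟩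
    rintro _ ⟨x, hx, rfl⟩
    exact hmQ x hx

/-- Image of a set containing one of the exchanged sets and disjoint from the other. -/
theorem image_exchange {M : Type*} {P Q R : Set M} {π : M ≃ M} (hQ : π '' Q = P)
    (hN : ∀ x, x ∉ P ∪ Q → π x = x) (hQR : Q ⊆ R) (hPR : Disjoint P R) :
    π '' R = R \ Q ∪ P := by
  have hfix : π '' (R \ Q) = R \ Q := by
    refine (image_congr fun x hx => hN x ?_).trans (image_id _)
    rintro (h | h)
    · exact Set.disjoint_left.1 hPR h hx.1
    · exact hx.2 h
  rw [← sdiff_union_of_subset hQR, image_union, hfix, hQ, sdiff_union_of_subset hQR]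

/-- A set containing both exchanged sets, or missing both, is preserved. -/
theorem image_exchange_eq_self {M : Type*} {P Q S : Set M} {π : M ≃ M} (hP : π '' P = Q)
    (hQ : π '' Q = P) (hN : ∀ x, x ∉ P ∪ Q → π x = x) (hS : P ∪ Q ⊆ S ∨ P ∪ Q ⊆ Sᶜ) :
    π '' S = S := by
  rcases hS with hS | hS
  · have hfix : π '' (S \ (P ∪ Q)) = S \ (P ∪ Q) :=
      (image_congr fun x hx => hN x hx.2).trans (image_id _)
    rw [← sdiff_union_of_subset hS, image_union, hfix, image_union, hP, hQ, union_comm Q P]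
  · exact (image_congr fun x hx => hN x fun h => hS h hx).trans (image_id _)

namespace PermInv

variable {M : Type*} {E : Set M → Set M → Prop}

theorem exchange_s6 (hPI : PermInv E) {P Q R S : Set M} (hRS : E R S) (hc : #P = #Q)
    (hQR : Q ⊆ R) (hPR : Disjoint P R) (hS : P ∪ Q ⊆ S ∨ P ∪ Q ⊆ Sᶜ) : E (R \ Q ∪ P) S := by
  obtain ⟨π, hP, hQ, hN⟩ := exists_perm_exchange (hPR.mono_right hQR) hc
  have h := (hPI π R S).1 hRS
  rwa [image_exchange hQ hN hQR hPR, image_exchange_eq_self hP hQ hN hS] at h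

/-- Exchanging `A ⊆ X \ Y` for `Z ⊆ Y \ X` preserves the class of `X` when there is an
equinumerous buffer `W` inside `X ∩ Y` or outside `X ∪ Y`. -/
theorem exchange_of_buffer (hPI : PermInv E) (hE : Equivalence E) {X Y Z A W : Set M}
    (hXY : E X Y) (hZ : Z ⊆ Y \ X) (hA : A ⊆ X \ Y) (hZA : #Z = #A) (hZW : #Z = #W)
    (hW : W ⊆ X ∩ Y ∨ W ⊆ (X ∪ Y)ᶜ) : E (X \ A ∪ Z) X := by
  have hZY := fun x (h : x ∈ Z) => (hZ h).1
  have hZX := fun x (h : x ∈ Z) => (hZ h).2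
  have hAX := fun x (h : x ∈ A) => (hA h).1
  have hAY := fun x (h : x ∈ A) => (hA h).2
  rcases hW with hW | hW
  · have hWX := fun x (h : x ∈ W) => (hW h).1
    have hWY := fun x (h : x ∈ W) => (hW h).2
    have h₁ : E (X \ W ∪ Z) Y := hPI.exchange_s6 hXY hZW hWX
      (Set.disjoint_left.2 hZX) (Or.inl (union_subset hZY hWY))
    have h₂ : E ((X \ W ∪ Z) \ A ∪ W) X := by
      refine hPI.exchange_s6 (hE.trans h₁ (hE.symm hXY)) (hZW.symm.trans hZA) ?_ ?_
        (Or.inl (union_subset hWX hAX))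
      · intro x hx
        exact Or.inl ⟨hAX x hx, fun h => hAY x hx (hWY x h)⟩
      · rw [Set.disjoint_left]
        rintro x hx (h | h)
        · exact h.2 hx
        · exact hZX x h (hWX x hx)
    convert h₂ using 1
    ext x
    have := hZY x; have := hZX x; have := hAX x; have := hAY x; have := hWX x; have := hWY x
    simp only [mem_union, mem_sdiff]
    tauto
  · have hWX := fun x (h : x ∈ W) (h' : x ∈ X) => hW h (Or.inl h')
    have hWY := fun x (h : x ∈ W) (h' : x ∈ Y) => hW h (Or.inr h')
    have h₁ : E (X \ A ∪ W) Y := hPI.exchange_s6 hXY (hZW.symm.trans hZA) hAX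
      (Set.disjoint_left.2 hWX) (Or.inr (union_subset hWY hAY))
    have h₂ : E ((X \ A ∪ W) \ W ∪ Z) X := by
      refine hPI.exchange_s6 (hE.trans h₁ (hE.symm hXY)) hZW subset_union_right ?_
        (Or.inr (union_subset hZX hWX))
      rw [Set.disjoint_left]
      rintro x hx (h | h)
      · exact hZX x hx h.1
      · exact hWY x h (hZY x hx)
    convert h₂ using 1
    ext x
    have := hWX x
    simp only [mem_union, mem_sdiff]
    tauto

/-- Exchanges along disjoint pieces of `Z` compose. -/
theorem exchange_union (hPI : PermInv E) (hE : Equivalence E) {X Z₁ Z₂ : Set M} {f : M → M}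
    (hZ : Disjoint (Z₁ ∪ Z₂) X) (hf : InjOn f (Z₁ ∪ Z₂)) (hfZ : f '' (Z₁ ∪ Z₂) ⊆ X)
    (hd : Disjoint Z₁ Z₂) (h₁ : E (X \ f '' Z₁ ∪ Z₁) X) (h₂ : E (X \ f '' Z₂ ∪ Z₂) X) :
    E (X \ f '' (Z₁ ∪ Z₂) ∪ (Z₁ ∪ Z₂)) X := by
  have hA : Disjoint (f '' Z₁) (f '' Z₂) :=
    hd.image hf subset_union_left subset_union_right
  rw [image_union] at hfZ ⊢
  have hfZ₁ := subset_union_left.trans hfZ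
  have hZ₁ : Disjoint Z₁ X := hZ.mono_left subset_union_left
  obtain ⟨π, -, hQ, hN⟩ := exists_perm_exchange (hZ₁.mono_right hfZ₁)
    (mk_image_eq_of_injOn f Z₁ (hf.mono subset_union_left)).symm
  have h := (hPI π _ _).1 h₂
  rw [image_exchange hQ hN hfZ₁ hZ₁, image_exchange hQ hN] at h
  · convert hE.trans h h₁ using 1
    ext x
    have : x ∈ Z₂ → x ∉ f '' Z₁ := fun h h' => Set.disjoint_left.1 hZ (Or.inr h) (hfZ₁ h')
    simp only [mem_union, mem_sdiff]
    tauto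
  · exact fun x hx => Or.inl ⟨hfZ₁ hx, Set.disjoint_left.1 hA hx⟩
  · exact disjoint_union_right.2 ⟨hZ₁.mono_right sdiff_subset, hd⟩

theorem exchange_of_trile (hPI : PermInv E) (hE : Equivalence E) {X Y Z W : Set M} {f : M → M}
    (hXY : E X Y) (hZ : Z ⊆ Y \ X) (hf : InjOn f Z) (hfZ : f '' Z ⊆ X \ Y)
    (hW : W ⊆ X ∩ Y ∨ W ⊆ (X ∪ Y)ᶜ) (hc : Trile #Z #W) : E (X \ f '' Z ∪ Z) X := by
  obtain ⟨n, hn⟩ := hc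
  induction n generalizing Z with
  | zero =>
    have : Z = ∅ := by simpa [mk_eq_zero_iff, isEmpty_coe_sort] using hn
    subst this
    simpa using hE.refl X
  | succ n ih =>
    obtain ⟨Z₁, Z₂, rfl, hd, hc₁, hc₂⟩ :
        ∃ Z₁ Z₂, Z = Z₁ ∪ Z₂ ∧ Disjoint Z₁ Z₂ ∧ #Z₁ ≤ n * #W ∧ #Z₂ ≤ #W := by
      have hn' : #Z ≤ #((ULift (Fin n) × W) ⊕ W : Type _) := by
        simpa [add_mul] using hn
      obtain ⟨e⟩ := hn'
      refine ⟨(↑) '' {z : Z | (e z).isLeft}, (↑) '' {z : Z | ¬ (e z).isLeft}, ?_, ?_, ?_, ?_⟩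
      · rw [← image_union, ← compl_ofPred, union_compl_self, image_univ, Subtype.range_coe]
      · rw [disjoint_image_iff Subtype.val_injective, ← compl_ofPred]
        exact disjoint_compl_right
      · rw [mk_image_eq Subtype.val_injective]
        have : #{z : Z | (e z).isLeft} ≤ #(ULift (Fin n) × W) :=
          mk_le_of_injective (f := fun z => (e z.1).getLeft z.2) fun a b h => by
            rw [← Sum.inl.injEq, Sum.inl_getLeft, Sum.inl_getLeft] at h
            exact Subtype.ext (e.injective h)
        simpa using this
      · rw [mk_image_eq Subtype.val_injective]
        exact mk_le_of_injective
          (f := fun z => (e z.1).getRight (by simpa using z.2)) fun a b h => by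
            rw [← Sum.inr.injEq, Sum.inr_getRight, Sum.inr_getRight] at h
            exact Subtype.ext (e.injective h)
    obtain ⟨W', hW', hcW⟩ := le_mk_iff_exists_subset.1 hc₂
    rw [image_union, union_subset_iff] at hfZ
    rw [union_subset_iff] at hZ
    refine hPI.exchange_union hE ?_ hf ?_ hd
      (ih hZ.1 (hf.mono subset_union_left) hfZ.1 hc₁)
      (hPI.exchange_of_buffer hE hXY hZ.2 hfZ.2
        (mk_image_eq_of_injOn f Z₂ (hf.mono subset_union_right)).symm hcW.symm
        (hW.imp hW'.trans hW'.trans))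
    · exact Set.disjoint_left.2 fun x hx => ((union_subset hZ.1 hZ.2) hx).2
    · rw [image_union]
      exact (union_subset hfZ.1 hfZ.2).trans sdiff_subset

end PermInv

/-- Lemma (shuttling into `X \ Y`). -/
theorem shuttle_into_diff {M : Type*} (E : Set M → Set M → Prop)
    (hE : Equivalence E) (hPI : PermInv E) (X Y Z : Set M) (f : M → M)
    (hYX : Y ≠ X) (hEXY : E X Y) (hZ : Z ⊆ Y \ X)
    (hfinj : Set.InjOn f Z) (hfZ : f '' Z ⊆ X \ Y)
    (hcard : Trile (Cardinal.mk Z) (Cardinal.mk (X ∩ Y : Set M)) ∨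
             Trile (Cardinal.mk Z) (Cardinal.mk ((X ∪ Y)ᶜ : Set M))) :
    ∃ π : M ≃ M, E (π '' X) X ∧ Z ⊆ π '' (X \ Y) ∧ π '' (X \ Y) ⊆ π '' X ∧
      ∀ x : M, π x ≠ x ↔ x ∈ Z ∪ f '' Z := by
  have hex : E (X \ f '' Z ∪ Z) X := by
    rcases hcard with h | h
    · exact hPI.exchange_of_trile hE hEXY hZ hfinj hfZ (Or.inl Subset.rfl) h
    · exact hPI.exchange_of_trile hE hEXY hZ hfinj hfZ (Or.inr Subset.rfl) h
  have hZX : Disjoint Z X := Set.disjoint_left.2 fun x hx => (hZ hx).2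
  have hfX : f '' Z ⊆ X := hfZ.trans sdiff_subset
  have hd : Disjoint Z (f '' Z) := hZX.mono_right hfX
  obtain ⟨π, hP, hQ, hN⟩ := exists_perm_exchange hd (mk_image_eq_of_injOn f Z hfinj).symm
  refine ⟨π, ?_, ?_, image_mono sdiff_subset, fun x => ⟨not_imp_comm.1 (hN x), ?_⟩⟩
  · rwa [image_exchange hQ hN hfX hZX]
  · exact hQ.symm.subset.trans (image_mono hfZ)
  · rintro (hx | hx) h
    · exact Set.disjoint_left.1 hd hx (hP ▸ ⟨x, hx, h⟩)
    · exact Set.disjoint_left.1 hd (hQ ▸ ⟨x, hx, h⟩) hx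
end

section
/- Relative categoricity theorem: let E assign to every type M an equivalence relation E_M on Set M that is isomorphism invariant, i.e., for every bijection e : M ≃ N and all X, Y : Set M, E_M X Y ↔ E_N (e '' X) (e '' Y). Then A_E is relatively categorical if and only if A_E is cardinality coarsening on abstracts. Here: A_E is relatively categorical means: for every type M and all ∂₁, ∂₂ : Set M → M each satisfying A_E on M, there is a bijection Γ between the sets Set.range ∂₁ and Set.range ∂₂ such that for every X : Set M with X ⊆ Set.range ∂₁, Γ (∂₁ X) = ∂₂ (Γ '' X). A_E is cardinality coarsening on abstracts means: for every type M, every ∂ satisfying A_E on M, and all X, Y : Set M, if Cardinal.mk X = Cardinal.mk Y ≤ Cardinal.mk (Set.range ∂) then E_M X Y. -/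
universe u

/-- The abstraction principle `A_E` for a relation `E` on concepts. -/
def Abstracts {M : Type u} (E : Set M → Set M → Prop) (d : Set M → M) : Prop :=
  ∀ X Y : Set M, d X = d Y ↔ E X Y

/-- Any two abstraction operators for `E` are isomorphic on their abstracts. -/
def RelCategorical {M : Type u} (E : Set M → Set M → Prop) : Prop :=
  ∀ d₁ d₂ : Set M → M, Abstracts E d₁ → Abstracts E d₂ →
    ∃ Γ : M → M, Set.BijOn Γ (Set.range d₁) (Set.range d₂) ∧
      ∀ X : Set M, X ⊆ Set.range d₁ → Γ (d₁ X) = d₂ (Γ '' X)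

/-- `E` relates any two equinumerous concepts of size at most the number of abstracts. -/
def CardCoarsening {M : Type u} (E : Set M → Set M → Prop) : Prop :=
  ∀ d : Set M → M, Abstracts E d → ∀ X Y : Set M, Cardinal.mk X = Cardinal.mk Y →
    Cardinal.mk Y ≤ Cardinal.mk (Set.range d) → E X Y

section

variable {M : Type u} {E : Set M → Set M → Prop} {d : Set M → M}

theorem Abstracts.comp (hd : Abstracts E d) {j : M → M} (hj : Function.Injective j) :
    Abstracts E (fun X => j (d X)) :=
  fun X Y => hj.eq_iff.trans (hd X Y)

theorem CardCoarsening.relCategorical (h : CardCoarsening E) : RelCategorical E := by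
  intro d₁ d₂ h₁ h₂
  have key (X : Set M) : d₂ (Function.invFun d₁ (d₁ X)) = d₂ X :=
    (h₂ _ _).2 ((h₁ _ _).1 (Function.invFun_eq ⟨X, rfl⟩))
  have hbij : Set.BijOn (fun x => d₂ (Function.invFun d₁ x)) (Set.range d₁) (Set.range d₂) := by
    refine ⟨?_, ?_, ?_⟩
    · rintro _ ⟨X, rfl⟩
      exact ⟨_, rfl⟩
    · rintro _ ⟨X, rfl⟩ _ ⟨Y, rfl⟩ hXY
      simp only [key] at hXY
      exact (h₁ _ _).2 ((h₂ _ _).1 hXY)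
    · rintro _ ⟨X, rfl⟩
      exact ⟨d₁ X, ⟨X, rfl⟩, key X⟩
  refine ⟨_, hbij, fun X hX => ?_⟩
  simp only [key]
  refine (h₂ _ _).2 (h d₁ h₁ _ _ ?_ ?_)
  · exact (Cardinal.mk_image_eq_of_injOn _ _ (hbij.injOn.mono hX)).symm
  · rw [Cardinal.mk_image_eq_of_injOn _ _ (hbij.injOn.mono hX)]
    exact Cardinal.mk_le_mk_of_subset hX

/-- Two pairs of sets with equinumerous Venn regions are related by a permutation. -/
theorem exists_perm_image_eq {A B A' B' : Set M}
    (h₁ : Cardinal.mk (A ∩ B : Set M) = Cardinal.mk (A' ∩ B' : Set M))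
    (h₂ : Cardinal.mk (A \ B : Set M) = Cardinal.mk (A' \ B' : Set M))
    (h₃ : Cardinal.mk (B \ A : Set M) = Cardinal.mk (B' \ A' : Set M))
    (h₄ : Cardinal.mk ((A ∪ B)ᶜ : Set M) = Cardinal.mk ((A' ∪ B')ᶜ : Set M)) :
    ∃ π : M ≃ M, π '' A = A' ∧ π '' B = B' := by
  classical
  have main (c : Bool × Bool) : Nonempty
      ({x : M // (decide (x ∈ A), decide (x ∈ B)) = c} ≃
        {x : M // (decide (x ∈ A'), decide (x ∈ B')) = c}) := by
    rw [← Cardinal.eq]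
    rcases c with ⟨_ | _, _ | _⟩
    · convert h₄ using 5 <;> simp
    · convert h₃ using 5 <;> simp [and_comm]
    · convert h₂ using 5 <;> simp
    · convert h₁ using 5 <;> simp
  have e := fun c => (main c).some
  have he (x : M) := Equiv.ofFiberEquiv_map e x
  simp only [Prod.mk.injEq, decide_eq_decide] at he
  refine ⟨Equiv.ofFiberEquiv e, ?_, ?_⟩
  · ext y
    rw [Equiv.image_eq_preimage_symm, Set.mem_preimage, ← (he _).1, Equiv.apply_symm_apply]
  · ext y
    rw [Equiv.image_eq_preimage_symm, Set.mem_preimage, ← (he _).2, Equiv.apply_symm_apply]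

theorem PermInv.iff_of_mk_eq (hP : PermInv E) {A B A' B' : Set M}
    (h₁ : Cardinal.mk (A ∩ B : Set M) = Cardinal.mk (A' ∩ B' : Set M))
    (h₂ : Cardinal.mk (A \ B : Set M) = Cardinal.mk (A' \ B' : Set M))
    (h₃ : Cardinal.mk (B \ A : Set M) = Cardinal.mk (B' \ A' : Set M))
    (h₄ : Cardinal.mk ((A ∪ B)ᶜ : Set M) = Cardinal.mk ((A' ∪ B')ᶜ : Set M)) :
    E A B ↔ E A' B' := by
  obtain ⟨π, rfl, rfl⟩ := exists_perm_image_eq h₁ h₂ h₃ h₄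
  exact hP π A B

/-- An infinite type contains two disjoint copies of itself. -/
theorem exists_injective_disjoint_range (M : Type u) [Infinite M] :
    ∃ j k : M → M, Function.Injective j ∧ Function.Injective k ∧ ∀ x y, j x ≠ k y := by
  have : Nonempty (M ⊕ M ≃ M) := by
    rw [← Cardinal.eq, Cardinal.mk_sum, Cardinal.lift_id,
      Cardinal.add_eq_self (Cardinal.aleph0_le_mk M)]
  obtain ⟨e⟩ := this
  exact ⟨fun x => e (.inl x), fun x => e (.inr x), fun x y h => by simpa using h,
    fun x y h => by simpa using h, fun x y h => by simp at h⟩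

theorem not_rel_of_disjoint [Infinite M] (hE : Equivalence E) (hP : PermInv E) {X Y : Set M}
    (hXY : Cardinal.mk X = Cardinal.mk Y) (hX : Cardinal.mk X < Cardinal.mk M) (hn : ¬ E X Y)
    {A B : Set M} (hA : Cardinal.mk A = Cardinal.mk X) (hB : Cardinal.mk B = Cardinal.mk X)
    (hAB : Disjoint A B) : ¬ E A B := by
  intro h
  have union_lt {S T : Set M} (hS : Cardinal.mk S = Cardinal.mk X)
      (hT : Cardinal.mk T = Cardinal.mk X) : Cardinal.mk (S ∪ T : Set M) < Cardinal.mk M :=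
    (Cardinal.mk_union_le _ _).trans_lt
      (Cardinal.add_lt_of_lt (Cardinal.aleph0_le_mk M) (hS ▸ hX) (hT ▸ hX))
  have all {S T : Set M} (hS : Cardinal.mk S = Cardinal.mk X)
      (hT : Cardinal.mk T = Cardinal.mk X) (hST : Disjoint S T) : E S T := by
    refine (hP.iff_of_mk_eq ?_ ?_ ?_ ?_).1 h
    · rw [hAB.inter_eq, hST.inter_eq]
    · rw [hAB.sdiff_eq_left, hST.sdiff_eq_left, hA, hS]
    · rw [hAB.sdiff_eq_right, hST.sdiff_eq_right, hB, hT]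
    · rw [Cardinal.mk_compl_of_infinite _ (union_lt hA hB),
        Cardinal.mk_compl_of_infinite _ (union_lt hS hT)]
  have : Cardinal.mk X ≤ Cardinal.mk ((X ∪ Y)ᶜ : Set M) := by
    rw [Cardinal.mk_compl_of_infinite _ (union_lt rfl hXY.symm)]
    exact hX.le
  obtain ⟨Z, hZ, hZX⟩ := Cardinal.le_mk_iff_exists_subset.1 this
  rw [Set.subset_compl_iff_disjoint_left, Set.disjoint_union_left] at hZ
  exact hn (hE.trans (all rfl hZX hZ.1) (hE.symm (all hXY.symm hZX hZ.2)))

/-- A type of size greater than `c` carries a rank function bounded on sets of size `c`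
with all fibres of full size. -/
theorem exists_rank [Infinite M] {c : Cardinal.{u}} (hc : c < Cardinal.mk M) :
    ∃ (W : Type u) (_ : LinearOrder W) (_ : WellFoundedLT W) (_ : W × M ≃ M),
      ∀ s : Set W, Cardinal.mk s ≤ c → ∃ w, ∀ x ∈ s, x < w := by
  obtain ⟨μ, hμ, hcμ, hμM⟩ : ∃ μ : Cardinal.{u}, μ.IsRegular ∧ c < μ ∧ μ ≤ Cardinal.mk M := by
    rcases lt_or_ge c Cardinal.aleph0 with h | h
    · exact ⟨_, Cardinal.isRegular_aleph0, h, Cardinal.aleph0_le_mk M⟩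
    · exact ⟨_, Cardinal.isRegular_succ h, Order.lt_succ c, Order.succ_le_of_lt hc⟩
  have : Nonempty (μ.ord.ToType × M ≃ M) := by
    rw [← Cardinal.eq, Cardinal.mk_prod, Cardinal.lift_id, Cardinal.lift_id,
      Cardinal.mk_ord_toType, Cardinal.mul_eq_right (Cardinal.aleph0_le_mk M) hμM hμ.ne_zero]
  refine ⟨μ.ord.ToType, inferInstance, inferInstance, this.some, fun s hs => ?_⟩
  have hs' : ¬ IsCofinal s := fun h => by
    have := Order.cof_le h
    rw [Ordinal.cof_toType, hμ.cof_ord] at this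
    exact (this.trans hs).not_gt hcμ
  simpa [IsCofinal] using hs'

theorem RelCategorical.rel_of_mk_lt [Infinite M] (hE : Equivalence E) (hP : PermInv E)
    (hR : RelCategorical E) (hd : Abstracts E d) {X Y : Set M}
    (hXY : Cardinal.mk X = Cardinal.mk Y) (hX : Cardinal.mk X < Cardinal.mk M) : E X Y := by
  classical
  by_contra hn
  have hX0 : Cardinal.mk X ≠ 0 := fun h0 => by
    have h0' := hXY ▸ h0
    rw [Cardinal.mk_set_eq_zero_iff] at h0 h0'
    exact hn (h0 ▸ h0' ▸ hE.refl _)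
  have hdisj {A B : Set M} (hA : Cardinal.mk A = Cardinal.mk X)
      (hB : Cardinal.mk B = Cardinal.mk X) (h : E A B) : ∃ x ∈ A, x ∈ B := by
    rw [← Set.not_disjoint_iff]
    exact fun hAB => not_rel_of_disjoint hE hP hXY hX hn hA hB hAB h
  -- an operator for which some set of abstracts `z` contains representatives of each `z`
  obtain ⟨j, k, hj, hk, hjk⟩ := exists_injective_disjoint_range M
  obtain ⟨e⟩ : Nonempty (M × X ≃ M) := by
    rw [← Cardinal.eq, Cardinal.mk_prod, Cardinal.lift_id, Cardinal.lift_id,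
      Cardinal.mul_eq_left (Cardinal.aleph0_le_mk M) hX.le hX0]
  let T (m : M) : Set M := Set.range fun l : X => j (e (m, l))
  have hT (m : M) : Cardinal.mk (T m) = Cardinal.mk X :=
    Cardinal.mk_range_eq _ fun a b h => by simpa using hj h
  have hTinj {m m' : M} (h : E (T m) (T m')) : m = m' := by
    obtain ⟨_, ⟨l, rfl⟩, ⟨l', h'⟩⟩ := hdisj (hT m) (hT m') h
    have := e.injective (hj h')
    exact (congrArg Prod.fst this).symm
  let d₁ (Z : Set M) : M := if h : ∃ m, E Z (T m) then j h.choose else k (d Z)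
  have hd₁T {Z : Set M} {m : M} (h : E Z (T m)) : d₁ Z = j m := by
    have h' : ∃ m, E Z (T m) := ⟨m, h⟩
    simp only [d₁, dif_pos h']
    rw [hTinj (hE.trans (hE.symm h'.choose_spec) h)]
  have hd₁k {Z : Set M} (h : ¬ ∃ m, E Z (T m)) : d₁ Z = k (d Z) := by
    simp only [d₁, dif_neg h]
  have hd₁ : Abstracts E d₁ := by
    intro A B
    by_cases hA : ∃ m, E A (T m)
    · obtain ⟨m, hm⟩ := hA
      rw [hd₁T hm]
      by_cases hB : ∃ m, E B (T m)
      · obtain ⟨m', hm'⟩ := hB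
        rw [hd₁T hm', hj.eq_iff]
        refine ⟨fun h => hE.trans hm (h ▸ hE.symm hm'), fun h => ?_⟩
        exact hTinj (hE.trans (hE.symm hm) (hE.trans h hm'))
      · rw [hd₁k hB]
        exact ⟨fun h => (hjk _ _ h).elim, fun h => (hB ⟨m, hE.trans (hE.symm h) hm⟩).elim⟩
    · rw [hd₁k hA]
      by_cases hB : ∃ m, E B (T m)
      · obtain ⟨m', hm'⟩ := hB
        rw [hd₁T hm']
        exact ⟨fun h => (hjk _ _ h.symm).elim, fun h => (hA ⟨m', hE.trans h hm'⟩).elim⟩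
      · rw [hd₁k hB, hk.eq_iff, hd]
  -- an operator whose values outrank their representatives
  obtain ⟨W, _, _, f, hW⟩ := exists_rank hX
  have hw (v : M) : ∃ w : W, ∀ Z, d Z = v → Cardinal.mk Z = Cardinal.mk X →
      ∃ Z₀, E Z Z₀ ∧ Cardinal.mk Z₀ = Cardinal.mk X ∧ ∀ z ∈ Z₀, (f.symm z).1 < w := by
    by_cases h : ∃ Z₀, d Z₀ = v ∧ Cardinal.mk Z₀ = Cardinal.mk X
    · obtain ⟨Z₀, hv, hZ₀⟩ := h
      obtain ⟨w, hw⟩ := hW ((fun z => (f.symm z).1) '' Z₀) (Cardinal.mk_image_le.trans hZ₀.le)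
      exact ⟨w, fun Z hZ _ => ⟨Z₀, (hd _ _).1 (hZ.trans hv.symm), hZ₀,
        fun z hz => hw _ ⟨z, hz, rfl⟩⟩⟩
    · exact ⟨(f.symm v).1, fun Z hZ hZX => (h ⟨Z, hZ, hZX⟩).elim⟩
  choose w hw using hw
  have hd₂ : Abstracts E (fun Z => f (w (d Z), d Z)) :=
    hd.comp (j := fun v => f (w v, v)) fun a b h => congrArg Prod.snd (f.injective h)
  obtain ⟨Γ, hΓ, hΓd⟩ := hR _ _ hd₁ hd₂
  have hjd (m : M) : d₁ (T m) = j m := hd₁T (hE.refl _)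
  have hTd (m : M) : T m ⊆ Set.range d₁ := by
    rintro _ ⟨l, rfl⟩
    exact ⟨_, hjd _⟩
  obtain ⟨m, -, hm⟩ := exists_minimalFor_of_wellFoundedLT (fun _ : M => True)
    (fun m => (f.symm (Γ (j m))).1) ⟨Classical.arbitrary M, trivial⟩
  have hZ : Cardinal.mk (Γ '' T m) = Cardinal.mk X :=
    (Cardinal.mk_image_eq_of_injOn _ _ (hΓ.injOn.mono (hTd m))).trans (hT m)
  have hΓm := hΓd _ (hTd m)
  rw [hjd] at hΓm
  obtain ⟨Z₀, hEZ, hZ₀, hlt⟩ := hw _ _ rfl hZ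
  obtain ⟨v, ⟨_, ⟨l, rfl⟩, rfl⟩, hv⟩ := hdisj hZ hZ₀ hEZ
  have hlt' : (f.symm (Γ (j (e (m, l))))).1 < (f.symm (Γ (j m))).1 := by
    rw [hΓm, Equiv.symm_apply_apply]
    exact hlt _ hv
  exact (hm trivial hlt'.le).not_gt hlt'

/-- `S` contains a copy of the whole domain. -/
def Large (S : Set M) : Prop := ∃ j : M → M, Function.Injective j ∧ ∀ x, j x ∈ S

theorem large_iff {S : Set M} : Large S ↔ Cardinal.mk S = Cardinal.mk M := by
  refine ⟨fun ⟨j, hj, hS⟩ => (Cardinal.mk_set_le S).antisymm ?_, fun h => ?_⟩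
  · exact Cardinal.mk_le_of_injective (f := fun x => (⟨j x, hS x⟩ : S))
      fun x y h => hj (congrArg Subtype.val h)
  · obtain ⟨e⟩ := Cardinal.eq.1 h.symm
    exact ⟨fun x => e x, Subtype.val_injective.comp e.injective, fun x => (e x).2⟩

theorem Large.mono {S T : Set M} (h : Large S) (hST : S ⊆ T) : Large T :=
  let ⟨j, hj, hS⟩ := h
  ⟨j, hj, fun x => hST (hS x)⟩

theorem Large.image {S : Set M} (h : Large S) {f : M → M} (hf : Function.Injective f) :
    Large (f '' S) :=
  let ⟨j, hj, hS⟩ := h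
  ⟨fun x => f (j x), hf.comp hj, fun x => ⟨_, hS x, rfl⟩⟩

theorem Large.or_of_union [Infinite M] {S T U : Set M} (h : Large U) (hU : U ⊆ S ∪ T) :
    Large S ∨ Large T := by
  have hST := large_iff.1 (h.mono hU)
  by_contra! hn
  rw [large_iff, large_iff] at hn
  have := (Cardinal.mk_union_le S T).trans_lt
    (Cardinal.add_lt_of_lt (Cardinal.aleph0_le_mk M) ((Cardinal.mk_set_le S).lt_of_ne hn.1)
      ((Cardinal.mk_set_le T).lt_of_ne hn.2))
  exact this.ne hST

theorem Large.exists_split [Infinite M] (S : Set M) :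
    ∃ Z ⊆ S, Large S → Large Z ∧ Large (S \ Z) := by
  by_cases h : Large S
  · obtain ⟨i, hi, hS⟩ := h
    obtain ⟨j, k, hj, hk, hjk⟩ := exists_injective_disjoint_range M
    refine ⟨Set.range fun x => i (j x), ?_, fun _ => ⟨⟨_, hi.comp hj, fun x => ⟨x, rfl⟩⟩,
      fun x => i (k x), hi.comp hk, fun x => ⟨hS _, ?_⟩⟩⟩
    · rintro _ ⟨x, rfl⟩
      exact hS _
    · rintro ⟨y, hy⟩
      exact hjk _ _ (hi hy)
  · exact ⟨∅, Set.empty_subset _, fun h' => (h h').elim⟩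

/-- All four Venn regions of `A` and `B` are of full size. -/
def Generic (A B : Set M) : Prop :=
  Large (A ∩ B) ∧ Large (A \ B) ∧ Large (B \ A) ∧ Large (A ∪ B)ᶜ

theorem exists_generic [Infinite M] {A B : Set M} (hA : Large A) (hA' : Large Aᶜ)
    (hB : Large B) (hB' : Large Bᶜ) : ∃ Z, Generic A Z ∧ Generic B Z := by
  obtain ⟨Z₁, h₁, s₁⟩ := Large.exists_split (A ∩ B)
  obtain ⟨Z₂, h₂, s₂⟩ := Large.exists_split (A \ B)
  obtain ⟨Z₃, h₃, s₃⟩ := Large.exists_split (B \ A)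
  obtain ⟨Z₄, h₄, s₄⟩ := Large.exists_split (A ∪ B)ᶜ
  refine ⟨Z₁ ∪ Z₂ ∪ Z₃ ∪ Z₄, ⟨?_, ?_, ?_, ?_⟩, ⟨?_, ?_, ?_, ?_⟩⟩
  · rcases hA.or_of_union (S := A ∩ B) (T := A \ B) (by grind) with h | h
    · exact (s₁ h).1.mono (by grind)
    · exact (s₂ h).1.mono (by grind)
  · rcases hA.or_of_union (S := A ∩ B) (T := A \ B) (by grind) with h | h
    · exact (s₁ h).2.mono (by grind)
    · exact (s₂ h).2.mono (by grind)
  · rcases hA'.or_of_union (S := B \ A) (T := (A ∪ B)ᶜ) (by grind) with h | h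
    · exact (s₃ h).1.mono (by grind)
    · exact (s₄ h).1.mono (by grind)
  · rcases hA'.or_of_union (S := B \ A) (T := (A ∪ B)ᶜ) (by grind) with h | h
    · exact (s₃ h).2.mono (by grind)
    · exact (s₄ h).2.mono (by grind)
  · rcases hB.or_of_union (S := A ∩ B) (T := B \ A) (by grind) with h | h
    · exact (s₁ h).1.mono (by grind)
    · exact (s₃ h).1.mono (by grind)
  · rcases hB.or_of_union (S := A ∩ B) (T := B \ A) (by grind) with h | h
    · exact (s₁ h).2.mono (by grind)
    · exact (s₃ h).2.mono (by grind)
  · rcases hB'.or_of_union (S := A \ B) (T := (A ∪ B)ᶜ) (by grind) with h | h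
    · exact (s₂ h).1.mono (by grind)
    · exact (s₄ h).1.mono (by grind)
  · rcases hB'.or_of_union (S := A \ B) (T := (A ∪ B)ᶜ) (by grind) with h | h
    · exact (s₂ h).2.mono (by grind)
    · exact (s₄ h).2.mono (by grind)

/-- There is a family of pairwise generic sets indexed by the powerset. -/
theorem exists_generic_family (M : Type u) [Infinite M] :
    ∃ F : Set M → Set M, ∀ S T, S ≠ T → Generic (F S) (F T) := by
  obtain ⟨φ⟩ : Nonempty (M × M × Bool × Bool ≃ M) := by
    have h := Cardinal.aleph0_le_mk M
    have h4 : Cardinal.mk (Bool × Bool) < Cardinal.aleph0 := Cardinal.lt_aleph0_of_finite _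
    rw [← Cardinal.eq, Cardinal.mk_prod, Cardinal.mk_prod]
    simp only [Cardinal.lift_uzero, Cardinal.lift_id]
    rw [Cardinal.mul_eq_left h _ (by simp)]
    exact (mul_le_mul' le_rfl ((Cardinal.lift_lt_aleph0.2 h4).le.trans h)).trans
      (Cardinal.mul_eq_self h).le
  let F (S : Set M) : Set M :=
    φ '' {p | (p.2.2.1 = true ∧ p.2.2.2 = true) ∨ (p.2.2.1 = false ∧ (p.1 ∈ S ↔ p.2.2.2 = true))}
  have large {R : Set M} (m : M) (b b' : Bool) (h : ∀ n, φ (m, n, b, b') ∈ R) : Large R :=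
    ⟨fun n => φ (m, n, b, b'), fun x y h => by simpa using h, h⟩
  refine ⟨F, fun S T hST => ?_⟩
  obtain ⟨m, hm⟩ : ∃ m, ¬ (m ∈ S ↔ m ∈ T) := by
    by_contra! h
    exact hST (Set.ext h)
  refine ⟨large m true true ?_, ?_, ?_, large m true false ?_⟩
  · simp [F]
  · by_cases h : m ∈ S
    · exact large m false true (by simp_all [F])
    · exact large m false false (by simp_all [F])
  · by_cases h : m ∈ S
    · exact large m false false (by simp_all [F])
    · exact large m false true (by simp_all [F])
  · simp [F]

theorem Abstracts.rel_of_large [Infinite M] (hE : Equivalence E) (hP : PermInv E)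
    (hd : Abstracts E d) {A B : Set M} (hA : Large A) (hA' : Large Aᶜ)
    (hB : Large B) (hB' : Large Bᶜ) : E A B := by
  obtain ⟨F, hF⟩ := exists_generic_family M
  obtain ⟨S, T, hdF, hST⟩ := Function.not_injective_iff.1
    (Function.cantor_injective fun S => d (F S))
  have all {X Z : Set M} (h : Generic X Z) : E X Z := by
    have hG := hF S T hST
    simp only [Generic, large_iff] at h hG
    refine (hP.iff_of_mk_eq ?_ ?_ ?_ ?_).1 ((hd _ _).1 hdF)
    · rw [h.1, hG.1]
    · rw [h.2.1, hG.2.1]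
    · rw [h.2.2.1, hG.2.2.1]
    · rw [h.2.2.2, hG.2.2.2]
  obtain ⟨Z, hAZ, hBZ⟩ := exists_generic hA hA' hB hB'
  exact hE.trans (all hAZ) (hE.symm (all hBZ))

theorem RelCategorical.rel_of_mk_eq [Infinite M] (hE : Equivalence E) (hP : PermInv E)
    (hR : RelCategorical E) (hd : Abstracts E d) (hM : Cardinal.mk M ≤ Cardinal.mk (Set.range d))
    {X Y : Set M} (hX : Large X) (hY : Large Y) : E X Y := by
  obtain ⟨e⟩ := Cardinal.eq.1 ((Cardinal.mk_set_le (Set.range d)).antisymm hM)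
  obtain ⟨j, k, hj, hk, hjk⟩ := exists_injective_disjoint_range M
  have hd₁ : Abstracts E (fun X => e ⟨d X, Set.mem_range_self X⟩) := fun A B => by
    rw [e.injective.eq_iff, Subtype.mk.injEq, hd A B]
  have hsurj : Set.range (fun X => e ⟨d X, Set.mem_range_self X⟩) = Set.univ := by
    rw [Set.range_eq_univ]
    intro y
    obtain ⟨⟨_, X, rfl⟩, rfl⟩ := e.surjective y
    exact ⟨X, rfl⟩
  obtain ⟨Γ, hΓ, hΓd⟩ := hR _ _ hd₁ (hd₁.comp hj)
  rw [hsurj] at hΓ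
  have hinj : Function.Injective Γ := Set.injOn_univ.1 hΓ.injOn
  have hlarge (A : Set M) : Large (Γ '' A)ᶜ := by
    refine ⟨k, hk, ?_⟩
    rintro x ⟨a, -, ha⟩
    obtain ⟨B, hB⟩ := hΓ.mapsTo (Set.mem_univ a)
    exact hjk _ _ (hB.trans ha)
  have key := hd.rel_of_large hE hP (hX.image hinj) (hlarge X) (hY.image hinj) (hlarge Y)
  refine (hd₁ X Y).1 (hinj ?_)
  rw [hΓd X (hsurj ▸ Set.subset_univ X), hΓd Y (hsurj ▸ Set.subset_univ Y)]
  exact (hd₁.comp hj _ _).2 key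

/-- On a four-element domain, an operator separating the three pairings of its elements
can be twisted by a transposition. -/
theorem RelCategorical.false_of_four (hR : RelCategorical E) (hd : Abstracts E d) {a b c e : M}
    (hM : ∀ z, z = a ∨ z = b ∨ z = c ∨ z = e)
    (hab : a ≠ b) (hac : a ≠ c) (hae : a ≠ e) (hbc : b ≠ c) (hbe : b ≠ e) (hce : c ≠ e)
    (h₁ : ¬ E ∅ {a, b}) (h₂ : ¬ E ∅ {a, c}) (h₃ : ¬ E ∅ {a, e})
    (h₄ : ¬ E {a, b} {a, c}) (h₅ : ¬ E {a, b} {a, e}) (h₆ : ¬ E {a, c} {a, e}) : False := by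
  classical
  simp only [← hd _ _] at h₁ h₂ h₃ h₄ h₅ h₆
  have hK : Function.Bijective ![a, b, c, e] := by
    refine ⟨fun i j h => ?_, fun z => ?_⟩
    · fin_cases i <;> fin_cases j <;> simp_all [eq_comm]
    · rcases hM z with rfl | rfl | rfl | rfl
      exacts [⟨0, rfl⟩, ⟨1, rfl⟩, ⟨2, rfl⟩, ⟨3, rfl⟩]
  have hG : Function.Injective ![d ∅, d {a, b}, d {a, c}, d {a, e}] := by
    intro i j h
    fin_cases i <;> fin_cases j <;> simp_all [eq_comm]
  let K := Equiv.ofBijective _ hK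
  have : Finite M := Finite.of_equiv _ K
  obtain ⟨σ, hσ⟩ : ∃ σ : M ≃ M, ∀ i, σ (![d ∅, d {a, b}, d {a, c}, d {a, e}] i) = K i := by
    refine ⟨(Equiv.ofBijective _ (Finite.injective_iff_bijective.1
      (hG.comp K.symm.injective))).symm, fun i => ?_⟩
    rw [Equiv.symm_apply_eq]
    simp
  have s₀ : σ (d ∅) = a := hσ 0
  have s₁ : σ (d {a, b}) = b := hσ 1
  have s₂ : σ (d {a, c}) = c := hσ 2
  have s₃ : σ (d {a, e}) = e := hσ 3
  have hd₁ := hd.comp σ.injective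
  obtain ⟨Γ, hΓ, hΓd⟩ := hR _ _ hd₁ (hd₁.comp (Equiv.swap b c).injective)
  have hrange (z : M) : z ∈ Set.range fun X => σ (d X) := by
    rcases hM z with rfl | rfl | rfl | rfl
    exacts [⟨_, s₀⟩, ⟨_, s₁⟩, ⟨_, s₂⟩, ⟨_, s₃⟩]
  replace hΓd (Z : Set M) := hΓd Z fun z _ => hrange z
  have hΓa : Γ a = a := by
    have := hΓd ∅
    rwa [s₀, Set.image_empty, s₀, Equiv.swap_apply_of_ne_of_ne hab hac] at this
  obtain ⟨z, -, hz⟩ := hΓ.surjOn (show b ∈ _ from ⟨{a, c}, by simp [s₂]⟩)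
  have hz' : σ (d {a, z}) = z := by
    rcases hM z with rfl | rfl | rfl | rfl
    exacts [(hab (hΓa.symm.trans hz)).elim, s₁, s₂, s₃]
  have := hΓd {a, z}
  rw [hz', Set.image_pair, hΓa, hz, s₁, Equiv.swap_apply_left] at this
  exact hbc this

theorem mem_swap_image [DecidableEq M] {A : Set M} {a b z : M} :
    z ∈ Equiv.swap a b '' A ↔ Equiv.swap a b z ∈ A := by
  rw [Equiv.image_eq_preimage_symm, Set.mem_preimage, Equiv.symm_swap]

theorem swap_image_eq_self [DecidableEq M] {A : Set M} {a b : M} (h : a ∈ A ↔ b ∈ A) :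
    Equiv.swap a b '' A = A := by
  ext z
  rw [mem_swap_image, Equiv.swap_apply_def]
  split_ifs <;> simp_all

theorem mem_swap_image_of_mem [DecidableEq M] {A : Set M} {a b z : M} (ha : a ∈ A) (hb : b ∉ A) :
    z ∈ Equiv.swap a b '' A ↔ z = b ∨ z ∈ A ∧ z ≠ a := by
  rw [mem_swap_image, Equiv.swap_apply_def]
  grind

/-- If `E` relates `A` to one of its images under a transposition exchanging a member with a
nonmember, then it relates `A` to all of its images. -/
theorem rel_image_of_rel_swap [Finite M] [DecidableEq M] (hE : Equivalence E) (hP : PermInv E)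
    {A : Set M} {p q : M} (hp : p ∈ A) (hq : q ∉ A) (h : E A (Equiv.swap p q '' A))
    (g : Equiv.Perm M) : E A (g '' A) := by
  have key {x y : M} (hx : x ∈ A) (hy : y ∉ A) : E A (Equiv.swap x y '' A) := by
    have h₁ := (hP (Equiv.swap p x) _ _).1 h
    have e₁ : Equiv.swap p x '' (Equiv.swap p q '' A) = Equiv.swap x q '' A := by
      ext z
      rw [mem_swap_image, mem_swap_image_of_mem hp hq, mem_swap_image_of_mem hx hq,
        Equiv.swap_apply_def]
      split_ifs <;> grind
    rw [e₁, swap_image_eq_self (iff_of_true hp hx)] at h₁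
    have h₂ := (hP (Equiv.swap q y) _ _).1 h₁
    have e₂ : Equiv.swap q y '' (Equiv.swap x q '' A) = Equiv.swap x y '' A := by
      ext z
      rw [mem_swap_image, mem_swap_image_of_mem hx hq, mem_swap_image_of_mem hx hy,
        Equiv.swap_apply_def]
      split_ifs <;> grind
    rwa [e₂, swap_image_eq_self (iff_of_false hq hy)] at h₂
  induction g using Equiv.Perm.swap_induction_on with
  | one => simpa using hE.refl A
  | swap_mul f x y _ ih =>
    rw [Equiv.Perm.coe_mul, Set.image_comp]
    refine hE.trans ?_ ((hP (Equiv.swap x y) _ _).1 ih)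
    by_cases hx : x ∈ A <;> by_cases hy : y ∈ A
    · rw [swap_image_eq_self (iff_of_true hx hy)]
      exact hE.refl A
    · exact key hx hy
    · rw [Equiv.swap_comm]
      exact key hy hx
    · rw [swap_image_eq_self (iff_of_false hx hy)]
      exact hE.refl A

theorem RelCategorical.rel_of_finite [Finite M] (hE : Equivalence E) (hP : PermInv E)
    (hR : RelCategorical E) (hd : Abstracts E d) {X Y : Set M}
    (hXY : Cardinal.mk X = Cardinal.mk Y) : E X Y := by
  classical
  by_contra hn
  have perms {A B : Set M} (hAB : Cardinal.mk A = Cardinal.mk B) : ∃ π : M ≃ M, π '' A = B := by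
    obtain ⟨π, hπ, -⟩ := exists_perm_image_eq (A := A) (B := A) (A' := B) (B' := B)
      (by simpa using hAB) (by simp) (by simp)
      (by simpa using Cardinal.mk_compl_eq_mk_compl_finite_same hAB)
    exact ⟨π, hπ⟩
  have not_swap {A : Set M} {p q : M} (hA : Cardinal.mk A = Cardinal.mk X) (hp : p ∈ A)
      (hq : q ∉ A) : ¬ E A (Equiv.swap p q '' A) := by
    intro h
    obtain ⟨π, hπ⟩ := perms hA
    obtain ⟨ρ, hρ⟩ := perms (hA.trans hXY)
    have h₁ := rel_image_of_rel_swap hE hP hp hq h π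
    have h₂ := rel_image_of_rel_swap hE hP hp hq h ρ
    rw [hπ] at h₁
    rw [hρ] at h₂
    exact hn (hE.trans (hE.symm h₁) h₂)
  have not_nbr {A B : Set M} (p q : M) (hA : Cardinal.mk A = Cardinal.mk X) (hp : p ∈ A)
      (hq : q ∉ A) (hB : ∀ z, z ∈ B ↔ z = q ∨ z ∈ A ∧ z ≠ p) : ¬ E A B := by
    have : Equiv.swap p q '' A = B := by
      ext z
      rw [mem_swap_image_of_mem hp hq, hB]
    rw [← this]
    exact not_swap hA hp hq
  have not_empty {A : Set M} (hA : Cardinal.mk A = Cardinal.mk X) : ¬ E ∅ A := by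
    intro h
    obtain ⟨π, hπ⟩ := perms hA
    obtain ⟨ρ, hρ⟩ := perms (hA.trans hXY)
    have h₁ := (hP π _ _).1 h
    have h₂ := (hP ρ _ _).1 h
    rw [hπ, Set.image_empty] at h₁
    rw [hρ, Set.image_empty] at h₂
    exact hn (hE.trans (hE.symm h₁) h₂)
  have ne : X ≠ Y := fun h => hn (h ▸ hE.refl X)
  have hcard : X.ncard = Y.ncard := congrArg Cardinal.toNat hXY
  obtain ⟨x₀, hx₀, -⟩ : ∃ x ∈ X, x ∉ Y := by
    by_contra! h
    exact ne (Set.eq_of_subset_of_ncard_le h hcard.ge)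
  obtain ⟨y₀, -, hy₀⟩ : ∃ y ∈ Y, y ∉ X := by
    by_contra! h
    exact ne (Set.eq_of_subset_of_ncard_le h hcard.le).symm
  have card_nbr {x y : M} (hx : x ∈ X) (hy : y ∉ X) :
      Cardinal.mk (insert y (X \ {x}) : Set M) = Cardinal.mk X := by
    have : insert y (X \ {x}) = Equiv.swap x y '' X := by
      ext z
      rw [mem_swap_image_of_mem hx hy]
      simp
    rw [this, Cardinal.mk_image_eq (Equiv.injective _)]
  by_cases H : ∃ x ∈ X, x ≠ x₀ ∧ ∃ y ∉ X, y ≠ y₀ ∧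
      E (insert y₀ (X \ {x})) (insert y (X \ {x₀}))
  · obtain ⟨x, hx, hxx, y, hy, hyy, h⟩ := H
    have hxin (z : M) (hz : z ∈ X) : z = x ∨ z = x₀ := by
      by_contra! hz'
      have h₁ := (hP (Equiv.swap z x₀) _ _).1 h
      rw [swap_image_eq_self (by clear * - hz hz' hx hx₀ hy hy₀ hxx hyy; grind)] at h₁
      refine not_swap (card_nbr hx₀ hy) ?_ ?_ (hE.trans (hE.symm h) h₁) <;>
        clear * - hz hz' hx hx₀ hy hy₀ hxx hyy <;> grind
    have hyout (z : M) (hz : z ∉ X) : z = y ∨ z = y₀ := by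
      by_contra! hz'
      have h₁ := (hP (Equiv.swap y z) _ _).1 h
      rw [swap_image_eq_self (by clear * - hz hz' hx hx₀ hy hy₀ hxx hyy; grind)] at h₁
      refine not_swap (card_nbr hx₀ hy) ?_ ?_ (hE.trans (hE.symm h) h₁) <;>
        clear * - hz hz' hx hx₀ hy hy₀ hxx hyy <;> grind
    have e₁ : X = {x₀, x} := by clear * - hx hx₀ hy hy₀ hxx hyy hxin; grind
    have e₂ : insert y (X \ {x}) = {x₀, y} := by clear * - hx hx₀ hy hy₀ hxx hyy hxin; grind
    have e₃ : insert y₀ (X \ {x}) = {x₀, y₀} := by clear * - hx hx₀ hy hy₀ hxx hyy hxin; grind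
    have hM (z : M) : z = x₀ ∨ z = x ∨ z = y ∨ z = y₀ := by
      by_cases hz : z ∈ X
      · rcases hxin z hz with rfl | rfl <;> simp
      · rcases hyout z hz with rfl | rfl <;> simp
    refine hR.false_of_four hd (a := x₀) (b := x) (c := y) (e := y₀) hM
      hxx.symm (ne_of_mem_of_not_mem hx₀ hy) (ne_of_mem_of_not_mem hx₀ hy₀)
      (ne_of_mem_of_not_mem hx hy) (ne_of_mem_of_not_mem hx hy₀) hyy
      ?_ ?_ ?_ ?_ ?_ ?_
    all_goals simp only [← e₁, ← e₂, ← e₃]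
    · exact not_empty rfl
    · exact not_empty (card_nbr hx hy)
    · exact not_empty (card_nbr hx hy₀)
    · exact not_nbr x y rfl hx hy (by clear * - hx hx₀ hy hy₀ hxx hyy; grind)
    · exact not_nbr x y₀ rfl hx hy₀ (by clear * - hx hx₀ hy hy₀ hxx hyy; grind)
    · refine not_nbr y y₀ (card_nbr hx hy) ?_ ?_ ?_ <;>
        clear * - hx hx₀ hy hy₀ hxx hyy <;> grind
  · have hH {x y : M} (hx : x ∈ X) (hy : y ∉ X) (hxx : x ≠ x₀) :
        ¬ E (insert y₀ (X \ {x})) (insert y (X \ {x₀})) := by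
      by_cases hyy : y = y₀
      · subst hyy
        refine not_nbr x₀ x (card_nbr hx hy) ?_ ?_ ?_ <;>
          clear * - hx hx₀ hy hy₀ hxx <;> grind
      · exact fun h => H ⟨x, hx, hxx, y, hy, hyy, h⟩
    let G (m : M) : Set M :=
      if m ∈ X then if m = x₀ then X else insert y₀ (X \ {m}) else insert m (X \ {x₀})
    have hcG (m : M) : Cardinal.mk (G m) = Cardinal.mk X := by
      dsimp only [G]
      split_ifs with h₁ h₂
      exacts [rfl, card_nbr h₁ hy₀, card_nbr hx₀ h₁]
    have hG (m n : M) (hmn : m ≠ n) : ¬ E (G m) (G n) := by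
      dsimp only [G]
      split_ifs with h₁ h₂ h₃ h₄ h₃ h₄ h₃ h₄
      · exact (hmn (h₂.trans h₄.symm)).elim
      · exact not_nbr n y₀ rfl h₃ hy₀ (by simp)
      · exact not_nbr x₀ n rfl hx₀ h₃ (by simp)
      · exact fun h => not_nbr m y₀ rfl h₁ hy₀ (by simp) (hE.symm h)
      · refine not_nbr n m (card_nbr h₁ hy₀) ?_ ?_ ?_ <;>
          clear * - hmn h₁ h₃ hx₀ hy₀ <;> grind
      · exact hH h₁ h₃ h₂
      · exact fun h => not_nbr x₀ m rfl hx₀ h₁ (by simp) (hE.symm h)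
      · exact fun h => hH h₃ h₁ h₄ (hE.symm h)
      · refine not_nbr m n (card_nbr hx₀ h₁) ?_ ?_ ?_ <;>
          clear * - hmn h₁ h₃ hx₀ hy₀ <;> grind
    have hinj : Function.Injective fun o : Option M => d (o.elim ∅ G) := by
      rintro (_ | m) (_ | n) h
      · rfl
      · exact (not_empty (hcG n) ((hd _ _).1 h)).elim
      · exact (not_empty (hcG m) (hE.symm ((hd _ _).1 h))).elim
      · by_contra hmn
        exact hG m n (fun h => hmn (h ▸ rfl)) ((hd _ _).1 h)
    have := Nat.card_le_card_of_injective _ hinj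
    rw [Finite.card_option] at this
    omega

end

/-- Relative categoricity theorem: relative categoricity is equivalent to
cardinality coarsening on abstracts. -/
theorem relative_categoricity
    (E : ∀ M : Type u, Set M → Set M → Prop)
    (hEq : ∀ M : Type u, Equivalence (E M))
    (hInv : ∀ (M N : Type u) (e : M ≃ N) (X Y : Set M),
      E M X Y ↔ E N (e '' X) (e '' Y)) :
    ((∀ (M : Type u) (d₁ d₂ : Set M → M),
        (∀ X Y : Set M, d₁ X = d₁ Y ↔ E M X Y) →
        (∀ X Y : Set M, d₂ X = d₂ Y ↔ E M X Y) →
        ∃ Γ : M → M, Set.BijOn Γ (Set.range d₁) (Set.range d₂) ∧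
          ∀ X : Set M, X ⊆ Set.range d₁ → Γ (d₁ X) = d₂ (Γ '' X))
      ↔
      (∀ (M : Type u) (d : Set M → M),
        (∀ X Y : Set M, d X = d Y ↔ E M X Y) →
        ∀ X Y : Set M, Cardinal.mk X = Cardinal.mk Y →
          Cardinal.mk Y ≤ Cardinal.mk (Set.range d) → E M X Y)) := by
  constructor
  · intro h M d hd X Y hXY hY
    have hP : PermInv (E M) := fun π => hInv M M π
    have hR : RelCategorical (E M) := h M
    obtain hM | hM := finite_or_infinite M
    · exact hR.rel_of_finite (hEq M) hP hd hXY
    obtain hX | hX := (Cardinal.mk_set_le X).lt_or_eq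
    · exact hR.rel_of_mk_lt (hEq M) hP hd hXY hX
    · have hYM := hXY.symm.trans hX
      exact hR.rel_of_mk_eq (hEq M) hP hd (hYM ▸ hY) (large_iff.2 hX) (large_iff.2 hYM)
  · intro h M
    exact CardCoarsening.relCategorical (h M)
end
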